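/- Let (Z, d_Z) and (W, d_W) be metric spaces and f : Z → W an injective map. Suppose there exist constants α_Z, α_W > 1, C_Z, C_W, C_Ψ ≥ 1, L₂ ≥ L₁ > 0 and real-valued functions q, defined on ordered triples of pairwise distinct points of Z, and q', defined on ordered triples of pairwise distinct points of W, such that: (i) C_Z^{−1}·α_Z^{q(x,y,z)} ≤ d_Z(x, z)/d_Z(x, y) ≤ C_Z·α_Z^{q(x,y,z)} for all pairwise distinct x, y, z ∈ Z; (ii) C_W^{−1}·α_W^{q'(x',y',z')} ≤ d_W(x', z')/d_W(x', y') ≤ C_W·α_W^{q'(x',y',z')} for all pairwise distinct x', y', z' ∈ W; (iii) α_W^{q'(f(x),f(y),f(z))} ≤ C_Ψ·α_W^{L₂·q(x,y,z)} whenever q(x, y, z) ≥ 0, and α_W^{q'(f(x),f(y),f(z))} ≤ C_Ψ·α_W^{L₁·q(x,y,z)} whenever q(x, y, z) < 0. Then for all pairwise distinct x, y, z ∈ Z: d_W(f(x), f(z))/d_W(f(x), f(y)) ≤ η(d_Z(x, z)/d_Z(x, y)), where η(t) = λ·t^{θ₁} for 0 < t < 1 and η(t) = λ·t^{θ₂}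 for t ≥ 1, with θ₁ = (log α_W/log α_Z)·L₁, θ₂ = (log α_W/log α_Z)·L₂, and λ = C_W·C_Ψ·C_Z^{3·L₂·log α_W/log α_Z}. -/

import Mathlib

/-- The two-exponent power control function: `η(t) = λ·t^{θ₁}` for `t < 1` and
`η(t) = λ·t^{θ₂}` for `t ≥ 1`. -/
noncomputable def powerEta (θ₁ θ₂ lam t : ℝ) : ℝ :=
  if t < 1 then lam * t ^ θ₁ else lam * t ^ θ₂

/-- A change of base: `b ^ (L * q)` is a power of `a ^ q`. -/
lemma rpow_mul_eq_rpow_rpow_log_div_log {a b : ℝ} (ha : 1 < a) (hb : 0 < b) (L q : ℝ) :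
    b ^ (L * q) = (a ^ q) ^ (Real.log b / Real.log a * L) := by
  have ha0 : 0 < a := zero_lt_one.trans ha
  have hlog : Real.log a ≠ 0 := (Real.log_pos ha).ne'
  rw [← Real.rpow_mul ha0.le, Real.rpow_def_of_pos hb, Real.rpow_def_of_pos ha0]
  congr 1
  field_simp

/-- `powerEta` dominates the power function with the exponent `θ₁`. -/
lemma mul_rpow_left_le_powerEta {θ₁ θ₂ lam t : ℝ} (hθ : θ₁ ≤ θ₂) (hlam : 0 ≤ lam) :
    lam * t ^ θ₁ ≤ powerEta θ₁ θ₂ lam t := by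
  unfold powerEta
  split_ifs with h
  · exact le_rfl
  · exact mul_le_mul_of_nonneg_left (Real.rpow_le_rpow_of_exponent_le (not_lt.1 h) hθ) hlam

/-- `powerEta` dominates the power function with the exponent `θ₂` on the positive reals. -/
lemma mul_rpow_right_le_powerEta {θ₁ θ₂ lam t : ℝ} (hθ : θ₁ ≤ θ₂) (hlam : 0 ≤ lam)
    (ht : 0 < t) : lam * t ^ θ₂ ≤ powerEta θ₁ θ₂ lam t := by
  unfold powerEta
  split_ifs with h
  · exact mul_le_mul_of_nonneg_left (Real.rpow_le_rpow_of_exponent_ge ht h.le hθ) hlam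
  · exact le_rfl

theorem abstract_power_quasi_symmetry_estimate
    {Z W : Type*} [MetricSpace Z] [MetricSpace W]
    (f : Z → W) (hf : Function.Injective f)
    (αZ αW CZ CW CΨ L₁ L₂ : ℝ)
    (hαZ : 1 < αZ) (hαW : 1 < αW)
    (hCZ : 1 ≤ CZ) (hCW : 1 ≤ CW) (hCΨ : 1 ≤ CΨ)
    (hL₁ : 0 < L₁) (hL₁₂ : L₁ ≤ L₂)
    (q : Z → Z → Z → ℝ) (q' : W → W → W → ℝ)
    -- (i) `q` is visually comparable to distance ratios in `Z`
    (hq : ∀ x y z : Z, x ≠ y → x ≠ z → y ≠ z →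
      CZ⁻¹ * αZ ^ q x y z ≤ dist x z / dist x y ∧
      dist x z / dist x y ≤ CZ * αZ ^ q x y z)
    -- (ii) `q'` is visually comparable to distance ratios in `W`
    (hq' : ∀ x' y' z' : W, x' ≠ y' → x' ≠ z' → y' ≠ z' →
      CW⁻¹ * αW ^ q' x' y' z' ≤ dist x' z' / dist x' y' ∧
      dist x' z' / dist x' y' ≤ CW * αW ^ q' x' y' z')
    -- (iii) two-sided linear distortion bound relating `q'` of image triples to `q`
    (hqq'pos : ∀ x y z : Z, x ≠ y → x ≠ z → y ≠ z → 0 ≤ q x y z →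
      αW ^ q' (f x) (f y) (f z) ≤ CΨ * αW ^ (L₂ * q x y z))
    (hqq'neg : ∀ x y z : Z, x ≠ y → x ≠ z → y ≠ z → q x y z < 0 →
      αW ^ q' (f x) (f y) (f z) ≤ CΨ * αW ^ (L₁ * q x y z)) :
    ∀ x y z : Z, x ≠ y → x ≠ z → y ≠ z →
      dist (f x) (f z) / dist (f x) (f y) ≤
        powerEta (Real.log αW / Real.log αZ * L₁) (Real.log αW / Real.log αZ * L₂)
          (CW * CΨ * CZ ^ (3 * L₂ * Real.log αW / Real.log αZ))
          (dist x z / dist x y) := by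
  intro x y z hxy hxz hyz
  obtain ⟨hlow, -⟩ := hq x y z hxy hxz hyz
  have hup := (hq' (f x) (f y) (f z) (hf.ne hxy) (hf.ne hxz) (hf.ne hyz)).2
  have ht : 0 < dist x z / dist x y := div_pos (dist_pos.2 hxz) (dist_pos.2 hxy)
  generalize dist x z / dist x y = t at hlow ht ⊢
  have hs : 0 < Real.log αW / Real.log αZ := div_pos (Real.log_pos hαW) (Real.log_pos hαZ)
  have hexp : 3 * L₂ * Real.log αW / Real.log αZ = Real.log αW / Real.log αZ * (3 * L₂) := by
    ring
  rw [hexp]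
  have hC : 0 < CZ := zero_lt_one.trans_le hCZ
  have hut : αZ ^ q x y z ≤ CZ * t := (inv_mul_le_iff₀ hC).1 hlow
  have hθ := mul_le_mul_of_nonneg_left hL₁₂ hs.le
  have key : ∀ L, 0 < L → L ≤ L₂ →
      αW ^ q' (f x) (f y) (f z) ≤ CΨ * αW ^ (L * q x y z) →
      dist (f x) (f z) / dist (f x) (f y) ≤
        CW * CΨ * CZ ^ (Real.log αW / Real.log αZ * (3 * L₂)) *
          t ^ (Real.log αW / Real.log αZ * L) := by
    intro L hL hLL₂ h
    rw [rpow_mul_eq_rpow_rpow_log_div_log hαZ (zero_lt_one.trans hαW)] at h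
    generalize Real.log αW / Real.log αZ = s at hs h ⊢
    have hu : (αZ ^ q x y z) ^ (s * L) ≤ CZ ^ (s * (3 * L₂)) * t ^ (s * L) :=
      calc (αZ ^ q x y z) ^ (s * L) ≤ (CZ * t) ^ (s * L) :=
            Real.rpow_le_rpow (by positivity) hut (by positivity)
        _ = CZ ^ (s * L) * t ^ (s * L) := Real.mul_rpow hC.le ht.le
        _ ≤ CZ ^ (s * (3 * L₂)) * t ^ (s * L) := by
            gcongr
            · linarith
    calc dist (f x) (f z) / dist (f x) (f y) ≤ CW * αW ^ q' (f x) (f y) (f z) := hup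
      _ ≤ CW * (CΨ * (CZ ^ (s * (3 * L₂)) * t ^ (s * L))) := by
          gcongr
          exact h.trans (by gcongr)
      _ = CW * CΨ * CZ ^ (s * (3 * L₂)) * t ^ (s * L) := by ring
  rcases le_or_gt 0 (q x y z) with h | h
  · exact (key L₂ (hL₁.trans_le hL₁₂) le_rfl (hqq'pos x y z hxy hxz hyz h)).trans
      (mul_rpow_right_le_powerEta hθ (by positivity) ht)
  · exact (key L₁ hL₁ hL₁₂ (hqq'neg x y z hxy hxz hyz h)).trans
      (mul_rpow_left_le_powerEta hθ (by positivity))
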